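/- Let k be an algebraically closed field of characteristic zero and let n ≥ 1 and q ≥ 1 be integers. Let p ∈ ℙⁿ(k) be a point whose representatives have exactly s nonzero coordinates (1 ≤ s ≤ n+1). Then the fiber f_q⁻¹(p) of the power map is a finite set with exactly q^(s−1) elements. In particular, the fiber over every point of U = ℙⁿ(k) ∖ D has exactly q^n elements. -/

import Mathlib

/-- The power map `f_q : ℙⁿ(k) → ℙⁿ(k)` induced by `v ↦ (i ↦ (v i) ^ q)`. -/
noncomputable def powerMap (k : Type*) [Field k] (n q : ℕ) :
    Projectivization k (Fin (n + 1) → k) → Projectivization k (Fin (n + 1) → k) :=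
  fun p => Projectivization.mk k (fun i => p.rep i ^ q) (by
    have h := p.rep_nonzero
    rw [Function.ne_iff] at h ⊢
    obtain ⟨i, hi⟩ := h
    exact ⟨i, pow_ne_zero q hi⟩)

open Polynomial in
lemma card_roots_aux {k : Type*} [Field k] [IsAlgClosed k] [CharZero k] [DecidableEq k]
    (q : ℕ) (hq : 1 ≤ q) (w : k) :
    (nthRoots q w).toFinset.card = if w = 0 then 1 else q := by
  split_ifs with h
  · subst h
    have : (nthRoots q (0 : k)).toFinset = {0} := by
      ext x
      simp [show q ≠ 0 by omega]
    rw [this, Finset.card_singleton]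
  · have : NeZero q := ⟨by omega⟩
    have : NeZero (q : k) := ⟨by exact_mod_cast (show q ≠ 0 by omega)⟩
    obtain ⟨ζ, hζ⟩ := HasEnoughRootsOfUnity.exists_primitiveRoot k q
    rw [Multiset.toFinset_card_of_nodup (hζ.nthRoots_nodup h), hζ.card_nthRoots, if_pos]
    exact IsAlgClosed.exists_pow_nat_eq w (by omega)

lemma powerMap_eq_iff_aux {k : Type*} [Field k] (n q : ℕ)
    (x p : Projectivization k (Fin (n + 1) → k)) :
    powerMap k n q x = p ↔ ∃ a : k, ∀ i, a * p.rep i = x.rep i ^ q := by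
  conv_lhs => rw [← p.mk_rep]
  unfold powerMap
  rw [Projectivization.mk_eq_mk_iff']
  simp [funext_iff]

open Polynomial in
lemma powerMap_fiber_aux {k : Type*} [Field k] [IsAlgClosed k] [CharZero k]
    (n q : ℕ) (hq : 1 ≤ q) (p : Projectivization k (Fin (n + 1) → k)) :
    (powerMap k n q ⁻¹' {p}).Finite ∧ Nat.card (powerMap k n q ⁻¹' {p}) =
      q ^ (Set.ncard {i : Fin (n + 1) | p.rep i ≠ 0} - 1) := by
  classical
  have hq0 : q ≠ 0 := by omega
  obtain ⟨i0, hi0⟩ := Function.ne_iff.1 p.rep_nonzero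
  simp only [Pi.zero_apply] at hi0
  set v := p.rep with hv
  let T : Finset (Fin (n + 1) → k) := Fintype.piFinset (fun i =>
    if i = i0 then {1} else (nthRoots q (v i / v i0)).toFinset)
  have memT : ∀ u, u ∈ T ↔ u i0 = 1 ∧ ∀ i, u i ^ q = v i / v i0 := by
    intro u
    simp only [T, Fintype.mem_piFinset]
    constructor
    · intro h
      have h0 : u i0 = 1 := by simpa using h i0
      refine ⟨h0, fun i => ?_⟩
      by_cases hi : i = i0
      · subst hi; simp [h0, hi0]
      · simpa [hi, mem_nthRoots (show 0 < q by omega)] using h i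
    · rintro ⟨h0, h⟩ i
      by_cases hi : i = i0
      · subst hi; simp [h0]
      · simpa [hi, mem_nthRoots (show 0 < q by omega)] using h i
  have cardT : T.card = q ^ (Set.ncard {i : Fin (n + 1) | v i ≠ 0} - 1) := by
    have h1 : ∀ i, (if i = i0 then {1} else (nthRoots q (v i / v i0)).toFinset : Finset k).card
        = if i ∈ (Finset.univ.filter (fun i => v i ≠ 0)).erase i0 then q else 1 := by
      intro i
      by_cases hi : i = i0
      · simp [hi]
      · rw [if_neg hi, card_roots_aux q hq]
        by_cases h : v i = 0 <;> simp [hi, h, hi0]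
    have h2 : Set.ncard {i : Fin (n + 1) | v i ≠ 0}
        = (Finset.univ.filter (fun i => v i ≠ 0)).card := by
      rw [← Set.ncard_coe_finset]; simp
    rw [Fintype.card_piFinset, Finset.prod_congr rfl (fun i _ => h1 i), Finset.prod_ite_mem, h2,
      Finset.univ_inter, Finset.prod_const, Finset.card_erase_of_mem (by simp [hi0])]
  let G : Projectivization k (Fin (n + 1) → k) → (Fin (n + 1) → k) :=
    fun x i => x.rep i / x.rep i0
  have key : ∀ x, powerMap k n q x = p →
      ∃ a : k, a ≠ 0 ∧ x.rep i0 ≠ 0 ∧ ∀ i, a * v i = x.rep i ^ q := by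
    intro x hx
    obtain ⟨a, ha⟩ := (powerMap_eq_iff_aux n q x p).1 hx
    have ha0 : a ≠ 0 := by
      rintro rfl
      apply x.rep_nonzero
      funext i
      have := ha i
      rw [zero_mul] at this
      exact pow_eq_zero_iff hq0 |>.1 this.symm
    refine ⟨a, ha0, fun h => ?_, ha⟩
    have := ha i0
    rw [h, zero_pow hq0] at this
    exact (mul_ne_zero ha0 hi0) this
  have inj : Set.InjOn G (powerMap k n q ⁻¹' {p}) := by
    intro x hx y hy hxy
    obtain ⟨a, -, hx0, -⟩ := key x hx
    obtain ⟨b, -, hy0, -⟩ := key y hy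
    rw [← x.mk_rep, ← y.mk_rep, Projectivization.mk_eq_mk_iff']
    refine ⟨x.rep i0 / y.rep i0, ?_⟩
    funext i
    have h : x.rep i / x.rep i0 = y.rep i / y.rep i0 := congrFun hxy i
    rw [div_eq_div_iff hx0 hy0] at h
    simp only [Pi.smul_apply, smul_eq_mul]
    field_simp
    linear_combination -h
  have img : G '' (powerMap k n q ⁻¹' {p}) = ↑T := by
    ext u
    rw [Finset.mem_coe, memT]
    constructor
    · rintro ⟨x, hx, rfl⟩
      obtain ⟨a, ha0, hx0, ha⟩ := key x hx
      refine ⟨div_self hx0, fun i => ?_⟩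
      simp only [G]
      rw [div_pow, ← ha, ← ha, mul_div_mul_left _ _ ha0]
    · rintro ⟨h0, h⟩
      have hu : u ≠ 0 := by
        rintro rfl
        simp at h0
      obtain ⟨c, hc⟩ := Projectivization.exists_smul_eq_mk_rep k u hu
      have hc' : ∀ i, (Projectivization.mk k u hu).rep i = (c : k) * u i := by
        intro i; rw [← hc]; rfl
      refine ⟨Projectivization.mk k u hu, ?_, ?_⟩
      · refine (powerMap_eq_iff_aux n q _ p).2 ⟨(c : k) ^ q / v i0, fun i => ?_⟩
        rw [hc', mul_pow, h]
        ring
      · funext i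
        simp only [G]
        rw [hc', hc', h0, mul_one, mul_div_cancel_left₀ _ c.ne_zero]
  refine ⟨Set.Finite.of_finite_image (img ▸ T.finite_toSet) inj, ?_⟩
  rw [Nat.card_coe_set_eq, ← Set.ncard_image_of_injOn inj, img, Set.ncard_coe_finset, cardT]

/-- Over an algebraically closed field of characteristic zero, the fiber of the power
map `f_q` over a point with exactly `s` nonzero coordinates is finite with exactly
`q ^ (s - 1)` elements; in particular the fiber over any point all of whose
coordinates are nonzero has exactly `q ^ n` elements. -/
theorem powerMap_fiber_card {k : Type*} [Field k] [IsAlgClosed k] [CharZero k]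
    (n q : ℕ) (hn : 1 ≤ n) (hq : 1 ≤ q) :
    (∀ (p : Projectivization k (Fin (n + 1) → k)) (s : ℕ), 1 ≤ s → s ≤ n + 1 →
      Set.ncard {i : Fin (n + 1) | p.rep i ≠ 0} = s →
      (powerMap k n q ⁻¹' {p}).Finite ∧
        Nat.card (powerMap k n q ⁻¹' {p}) = q ^ (s - 1)) ∧
    (∀ p : Projectivization k (Fin (n + 1) → k), (∀ i, p.rep i ≠ 0) →
      Nat.card (powerMap k n q ⁻¹' {p}) = q ^ n) := by
  refine ⟨fun p s _ _ hs => hs ▸ powerMap_fiber_aux n q hq p, fun p hp => ?_⟩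
  rw [(powerMap_fiber_aux n q hq p).2]
  simp [hp, Set.ncard_univ]
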